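/- For every x ∈ [0,1], the one-step polarization maps x ↦ 2x − x² and x ↦ x² transform the increment Δ(x) = x(1 − x) multiplicatively as follows: (2x − x²)·(1 − (2x − x²)) = x(1 − x)·(1 − x)(2 − x), and x²·(1 − x²) = x(1 − x)·x(1 + x). Moreover, for every x ∈ [0,1], (1 − x)^{1/2}(2 − x)^{1/2} + x^{1/2}(1 + x)^{1/2} ≤ √3. -/

import Mathlib

/-- Pointwise multiplicative transformation of the increment `Δ(x) = x(1−x)` under the
one-step polarization maps `x ↦ 2x − x²` and `x ↦ x²`, together with the bound
`√(1−x)·√(2−x) + √x·√(1+x) ≤ √3` on `[0,1]`. -/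
theorem polarization_increment_identities :
    ∀ x ∈ Set.Icc (0:ℝ) 1,
      (2*x - x^2) * (1 - (2*x - x^2)) = x * (1 - x) * ((1 - x) * (2 - x))
      ∧ x^2 * (1 - x^2) = x * (1 - x) * (x * (1 + x))
      ∧ Real.sqrt (1 - x) * Real.sqrt (2 - x) + Real.sqrt x * Real.sqrt (1 + x)
          ≤ Real.sqrt 3 := by
  rintro x ⟨h0, h1⟩
  refine ⟨by ring, by ring, ?_⟩
  rw [← Real.sqrt_mul (by linarith), ← Real.sqrt_mul h0]
  have hA : 0 ≤ (1 - x) * (2 - x) := mul_nonneg (by linarith) (by linarith)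
  have hB : 0 ≤ x * (1 + x) := mul_nonneg h0 (by linarith)
  have hp : 0 ≤ x * (1 - x) := mul_nonneg h0 (by linarith)
  have hcross : 2 * (√((1 - x) * (2 - x)) * √(x * (1 + x))) ≤ 1 + 2 * (x * (1 - x)) := by
    refine le_of_abs_le (abs_le_of_sq_le_sq ?_ (by linarith))
    rw [mul_pow, mul_pow, Real.sq_sqrt hA, Real.sq_sqrt hB]
    -- The difference of the two sides is `1 - 4 * x * (1 - x) = (2 * x - 1) ^ 2`.
    linarith [sq_nonneg (2 * x - 1)]
  apply Real.le_sqrt_of_sq_le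
  linarith [add_sq (√((1 - x) * (2 - x))) (√(x * (1 + x))), Real.sq_sqrt hA, Real.sq_sqrt hB]
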